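/- arXiv:1001.4203 — 2 statements merged into one kernel-verified Lean document; each statement's English description precedes it below -/
import Mathlib

section
/- Let D ⊂ ℝ^d be compact, f₁,…,f_k injective continuous contractions with fᵢ(D°) ⊆ D° for all i, and μ_d(fᵢ(D) ∩ f_j(D)) = 0 for i ≠ j. Then for Y = closure(D \ Φ(D)) and all m ≠ n, μ_d(Φⁿ(Y) ∩ Φᵐ(Y)) = 0, provided μ_d(∂D) = 0. -/
open MeasureTheory

/-- `Φ(X) = ⋃ i, fᵢ(X)`. -/
def PhiMap {d k : ℕ} (f : Fin k → EuclideanSpace ℝ (Fin d) → EuclideanSpace ℝ (Fin d)) :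
    Set (EuclideanSpace ℝ (Fin d)) → Set (EuclideanSpace ℝ (Fin d)) :=
  fun X => ⋃ i, f i '' X

open Set Metric Module
open scoped NNReal ENNReal Topology

section LipschitzNull
variable {E : Type*} [NormedAddCommGroup E] [NormedSpace ℝ E] [FiniteDimensional ℝ E]
  [MeasurableSpace E] [BorelSpace E] (μ : Measure E) [μ.IsAddHaarMeasure]

theorem LipschitzOnWith.addHaar_image_eq_zero {K : ℝ≥0} {f : E → E} {s : Set E}
    (hf : LipschitzOnWith K f s) (hs : μ s = 0) : μ (f '' s) = 0 := by
  have hH : μH[finrank ℝ E] s = 0 :=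
    Measure.absolutelyContinuous_isAddHaarMeasure (μH[finrank ℝ E]) μ hs
  have h := hf.hausdorffMeasure_image_le (d := (finrank ℝ E : ℝ)) (Nat.cast_nonneg _)
  rw [hH, mul_zero, nonpos_iff_eq_zero] at h
  exact Measure.absolutelyContinuous_isAddHaarMeasure μ (μH[finrank ℝ E]) h

/-- `det (1 + t L)` is a combination of its values at small nodes, with weights
independent of `L`. -/
theorem exists_sum_mul_det_one_add_smul (E : Type*) [NormedAddCommGroup E] [NormedSpace ℝ E]
    [FiniteDimensional ℝ E] {ε : ℝ} (hε : 0 < ε) :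
    ∃ (s : Finset ℕ) (t c : ℕ → ℝ), (∀ j ∈ s, 0 ≤ t j ∧ t j < ε) ∧ ∑ j ∈ s, c j = 1 ∧
      ∀ L : E →L[ℝ] E, (1 + L).det = ∑ j ∈ s, c j * (1 + t j • L).det := by
  set s := Finset.range (finrank ℝ E + 1)
  set t : ℕ → ℝ := fun j => ε * (1 - 1 / ((j : ℝ) + 1)) with ht
  have hpos : ∀ j : ℕ, (0 : ℝ) < (j : ℝ) + 1 := fun j => by positivity
  have hinj : Set.InjOn t s := by
    intro i _ j _ hij
    simp only [ht, mul_eq_mul_left_iff, hε.ne', or_false, sub_right_inj] at hij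
    have := hpos i
    have := hpos j
    field_simp at hij
    exact_mod_cast (by linarith : (i : ℝ) = j)
  have hne : s.Nonempty := ⟨0, by simp [s]⟩
  refine ⟨s, t, fun j => (Lagrange.basis s t j).eval 1, fun j _ => ?_, ?_, fun L => ?_⟩
  · have h1 : 1 / ((j : ℝ) + 1) ≤ 1 := by
      rw [div_le_one (hpos j)]; linarith [(Nat.cast_nonneg j : (0 : ℝ) ≤ j)]
    have h2 : 0 < 1 / ((j : ℝ) + 1) := one_div_pos.2 (hpos j)
    exact ⟨mul_nonneg hε.le (by linarith), by simp only [ht]; nlinarith⟩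
  · rw [← Polynomial.eval_finsetSum, Lagrange.sum_basis hinj hne, Polynomial.eval_one]
  · let b := finBasis ℝ E
    let M := LinearMap.toMatrix b b (L : E →ₗ[ℝ] E)
    let p : Polynomial ℝ := ((Polynomial.X : Polynomial ℝ) • M.map Polynomial.C +
      (1 : Matrix (Fin (finrank ℝ E)) (Fin (finrank ℝ E)) ℝ).map Polynomial.C).det
    have hp : ∀ a : ℝ, p.eval a = (1 + a • L).det := by
      intro a
      have h1 : (1 + a • L).det = LinearMap.det (1 + a • (L : E →ₗ[ℝ] E)) := rfl
      rw [h1, ← LinearMap.det_toMatrix b, ← Polynomial.coe_evalRingHom, RingHom.map_det]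
      congr 1
      ext i j
      simp [M, LinearMap.toMatrix_one, Matrix.one_apply, apply_ite, add_comm]
      split_ifs <;> ring
    have hdeg : p.degree < s.card := by
      refine lt_of_le_of_lt Polynomial.degree_le_natDegree ?_
      have := Polynomial.natDegree_det_X_add_C_le M 1
      rw [Fintype.card_fin] at this
      rw [Finset.card_range]
      exact_mod_cast Nat.lt_succ_of_le this
    have h := congrArg (Polynomial.eval 1) (Lagrange.eq_interpolate hinj hdeg)
    rw [Lagrange.interpolate_apply, Polynomial.eval_finsetSum] at h
    simp only [Polynomial.eval_mul, Polynomial.eval_C, hp, one_smul] at h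
    rw [h]
    exact Finset.sum_congr rfl fun j _ => mul_comm _ _

theorem exists_pos_det_one_add_pos (E : Type*) [NormedAddCommGroup E] [NormedSpace ℝ E]
    [FiniteDimensional ℝ E] :
    ∃ δ : ℝ, 0 < δ ∧ ∀ L : E →L[ℝ] E, ‖L‖ < δ → 0 < (1 + L).det := by
  have hc : Continuous fun L : E →L[ℝ] E => (1 + L).det :=
    ContinuousLinearMap.continuous_det.comp (continuous_const.add continuous_id)
  have h0 : ∀ᶠ L in 𝓝 (0 : E →L[ℝ] E), 0 < (1 + L).det := by
    refine (hc.tendsto 0).eventually (lt_mem_nhds ?_)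
    simp [ContinuousLinearMap.det]
  obtain ⟨δ, hδ, h⟩ := Metric.eventually_nhds_iff.1 h0
  exact ⟨δ, hδ, fun L hL => h (by simpa using hL)⟩

theorem LipschitzWith.bijective_id_add {E : Type*} [NormedAddCommGroup E] [NormedSpace ℝ E]
    [CompleteSpace E] {K : ℝ≥0} {u : E → E} (hu : LipschitzWith K u) (hK : K < 1) :
    Function.Bijective fun x => x + u x := by
  have happ : ApproximatesLinearOn (fun x => x + u x)
      (ContinuousLinearEquiv.refl ℝ E : E →L[ℝ] E) univ K := by
    rw [ApproximatesLinearOn.approximatesLinearOn_iff_lipschitzOnWith, lipschitzOnWith_univ]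
    convert hu using 1
    ext x
    simp
  have hc : Subsingleton E ∨
      K < ‖((ContinuousLinearEquiv.refl ℝ E).symm : E →L[ℝ] E)‖₊⁻¹ := by
    rcases subsingleton_or_nontrivial E with h | h
    · exact Or.inl h
    · right
      simpa using hK
  exact ⟨injOn_univ.1 (happ.injOn hc), happ.surjective hc⟩

theorem image_eq_of_bijective_of_eqOn_compl {α : Type*} {F : α → α} {s : Set α}
    (hF : Function.Bijective F) (h : ∀ x ∉ s, F x = x) : F '' s = s := by
  have hc : F '' sᶜ = sᶜ := by
    ext x
    constructor
    · rintro ⟨y, hy, rfl⟩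
      rwa [h y hy]
    · exact fun hx => ⟨x, hx, h x hx⟩
  rw [image_compl_eq hF] at hc
  exact compl_injective hc

theorem setIntegral_det_one_add_smul_fderiv {K : ℝ≥0} {u : E → E} (hu : LipschitzWith K u)
    {s : Set E} (hs : MeasurableSet s) (hsf : μ s ≠ ∞) (hus : ∀ x ∉ s, u x = 0) {t : ℝ}
    (ht : 0 ≤ t) (htK : t * K < 1)
    (hpos : ∀ x, 0 < (1 + t • fderiv ℝ u x).det) :
    IntegrableOn (fun x => (1 + t • fderiv ℝ u x).det) s μ ∧
      ∫ x in s, (1 + t • fderiv ℝ u x).det ∂μ = μ.real s := by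
  set F : E → E := fun x => x + t • u x with hF
  have htu : LipschitzWith (t.toNNReal * K) fun x => t • u x := by
    refine LipschitzWith.of_dist_le_mul fun x y => ?_
    rw [dist_smul₀, NNReal.coe_mul, Real.coe_toNNReal _ ht, Real.norm_of_nonneg ht, mul_assoc]
    exact mul_le_mul_of_nonneg_left (hu.dist_le_mul x y) ht
  have hFL : LipschitzWith (1 + t.toNNReal * K) F := LipschitzWith.id.add htu
  have hbij : Function.Bijective F := by
    refine htu.bijective_id_add ?_
    rw [← NNReal.coe_lt_coe, NNReal.coe_mul, Real.coe_toNNReal _ ht]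
    exact htK
  have himg : F '' s = s :=
    image_eq_of_bijective_of_eqOn_compl hbij fun x hx => by simp [hF, hus x hx]
  set A := {x | DifferentiableAt ℝ u x}
  have hA : MeasurableSet A := measurableSet_of_differentiableAt ℝ u
  have hAc : μ (s \ A) = 0 := measure_mono_null (fun x hx => hx.2) hu.ae_differentiableAt
  have hae : (s ∩ A : Set E) =ᵐ[μ] s := by
    refine ae_eq_set.2 ⟨measure_mono_null (fun x hx => (hx.2 hx.1.1).elim) measure_empty, ?_⟩
    rwa [sdiff_self_inter]
  have hder : ∀ x ∈ s ∩ A, HasFDerivWithinAt F (1 + t • fderiv ℝ u x) (s ∩ A) x := fun x hx =>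
    ((hasFDerivAt_id x).add (hx.2.hasFDerivAt.const_smul t)).hasFDerivWithinAt
  have harea := lintegral_abs_det_fderiv_eq_addHaar_image μ (hs.inter hA) hder hbij.1.injOn
  have hvol : μ (F '' (s ∩ A)) = μ s := by
    refine le_antisymm ((measure_mono (image_mono inter_subset_left)).trans_eq (by rw [himg])) ?_
    calc μ s = μ (F '' (s ∩ A) ∪ F '' (s \ A)) := by
          rw [← image_union, inter_union_sdiff, himg]
      _ ≤ μ (F '' (s ∩ A)) + μ (F '' (s \ A)) := measure_union_le _ _
      _ = μ (F '' (s ∩ A)) := by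
          rw [hFL.lipschitzOnWith.addHaar_image_eq_zero μ hAc, add_zero]
  rw [hvol, setLIntegral_congr hae] at harea
  simp only [abs_of_pos (hpos _)] at harea
  have hmeas : Measurable fun x => (1 + t • fderiv ℝ u x).det :=
    ContinuousLinearMap.continuous_det.measurable.comp
      (measurable_const.add ((measurable_fderiv ℝ u).const_smul t))
  have hnn : 0 ≤ᵐ[μ.restrict s] fun x => (1 + t • fderiv ℝ u x).det :=
    Filter.Eventually.of_forall fun x => (hpos x).le
  refine ⟨⟨hmeas.aestronglyMeasurable, ?_⟩, ?_⟩
  · rw [hasFiniteIntegral_iff_ofReal hnn, harea]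
    exact hsf.lt_top
  · rw [integral_eq_lintegral_of_nonneg_ae hnn hmeas.aestronglyMeasurable, harea, measureReal_def]

/-- The determinant of a Lipschitz perturbation of the identity supported in `s` integrates to the
measure of `s`. -/
theorem setIntegral_det_one_add_fderiv {K : ℝ≥0} {u : E → E} (hu : LipschitzWith K u)
    {s : Set E} (hs : MeasurableSet s) (hsf : μ s ≠ ∞) (hus : ∀ x ∉ s, u x = 0) :
    ∫ x in s, (1 + fderiv ℝ u x).det ∂μ = μ.real s := by
  obtain ⟨δ, hδ, hdet⟩ := exists_pos_det_one_add_pos E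
  have hK : (0 : ℝ) < K + 1 := by positivity
  obtain ⟨J, t, c, ht, hc, hsum⟩ := exists_sum_mul_det_one_add_smul E
    (div_pos (lt_min hδ one_pos) hK)
  have key : ∀ j ∈ J, t j * K < min δ 1 := fun j hj => by
    have h := (lt_div_iff₀ hK).1 (ht j hj).2
    nlinarith [(ht j hj).1]
  have h := fun j (hj : j ∈ J) => setIntegral_det_one_add_smul_fderiv μ hu hs hsf hus (ht j hj).1
    ((key j hj).trans_le (min_le_right _ _)) fun x => hdet _ <| by
      rw [norm_smul, Real.norm_of_nonneg (ht j hj).1]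
      exact (mul_le_mul_of_nonneg_left (norm_fderiv_le_of_lipschitz ℝ hu) (ht j hj).1).trans_lt
        ((key j hj).trans_le (min_le_left _ _))
  rw [show (fun x => (1 + fderiv ℝ u x).det) = fun x => ∑ j ∈ J, c j * (1 + t j • fderiv ℝ u x).det
    from funext fun x => hsum _]
  rw [integral_finsetSum _ fun j hj => (h j hj).1.const_mul _]
  simp only [integral_const_mul]
  rw [Finset.sum_congr rfl fun j hj => by rw [(h j hj).2], ← Finset.sum_mul, hc, one_mul]

end LipschitzNull
section Open
variable {E : Type*} [NormedAddCommGroup E] [InnerProductSpace ℝ E]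

theorem lipschitzOnWith_max_div_norm_smul {F : Type*} [NormedAddCommGroup F] [NormedSpace ℝ F]
    {R c : ℝ≥0} (hc : 0 < c) :
    LipschitzOnWith (max (R / c) 1 + R / c) (fun w : F => max (R / ‖w‖) 1 • w)
      {w | (c : ℝ) ≤ ‖w‖} := by
  refine LipschitzOnWith.of_dist_le_mul fun w hw v hv => ?_
  have hc' : (0 : ℝ) < c := hc
  have hw0 : 0 < ‖w‖ := hc'.trans_le hw
  have hv0 : 0 < ‖v‖ := hc'.trans_le hv
  have hRc : R / ‖w‖ ≤ (R : ℝ) / c := div_le_div_of_nonneg_left R.coe_nonneg hc' hw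
  rw [dist_eq_norm, dist_eq_norm]
  push_cast
  have h1 : max (R / ‖w‖) 1 • w - max (R / ‖v‖) 1 • v =
      max (R / ‖w‖) 1 • (w - v) + (max (R / ‖w‖) 1 - max (R / ‖v‖) 1) • v := by
    rw [smul_sub, sub_smul]; abel
  have h2 : |R / ‖w‖ - R / ‖v‖| * ‖v‖ ≤ R / c * ‖w - v‖ := by
    have h3 : R / ‖w‖ - R / ‖v‖ = R / ‖w‖ * ((‖v‖ - ‖w‖) / ‖v‖) := by
      field_simp
    rw [h3, abs_mul, abs_of_nonneg (div_nonneg R.coe_nonneg hw0.le), abs_div, abs_of_pos hv0, mul_assoc,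
      div_mul_cancel₀ _ hv0.ne']
    refine mul_le_mul hRc ?_ (abs_nonneg _) (div_nonneg R.coe_nonneg hc'.le)
    rw [norm_sub_rev]
    exact abs_norm_sub_norm_le v w
  rw [h1]
  refine (norm_add_le _ _).trans ?_
  rw [norm_smul, norm_smul, Real.norm_eq_abs, Real.norm_eq_abs, add_mul,
    abs_of_pos (lt_max_of_lt_right one_pos)]
  refine add_le_add (mul_le_mul_of_nonneg_right (max_le_max_right _ hRc) (norm_nonneg _)) ?_
  exact (mul_le_mul_of_nonneg_right (abs_max_sub_max_le_abs _ _ _) (norm_nonneg _)).trans h2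

theorem LipschitzWith.smul_of_bounded_on_support {α F : Type*} [PseudoMetricSpace α]
    [NormedAddCommGroup F] [NormedSpace ℝ F] {χ : α → ℝ} {v : α → F} {A B M : ℝ≥0} {s : Set α}
    (hχ : LipschitzWith A χ) (hv : LipschitzWith B v) (hχ1 : ∀ x, |χ x| ≤ 1)
    (hχs : ∀ x ∉ s, χ x = 0) (hvM : ∀ x ∈ s, ‖v x‖ ≤ M) :
    LipschitzWith (B + A * M) fun x => χ x • v x := by
  have key : ∀ x, ∀ y ∈ s, dist (χ x • v x) (χ y • v y) ≤ ↑(B + A * M) * dist x y := by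
    intro x y hy
    have h1 : χ x • v x - χ y • v y = χ x • (v x - v y) + (χ x - χ y) • v y := by
      rw [smul_sub, sub_smul]; abel
    rw [dist_eq_norm, h1]
    refine (norm_add_le _ _).trans ?_
    rw [norm_smul, norm_smul, ← dist_eq_norm, ← dist_eq_norm, Real.norm_eq_abs]
    push_cast
    have h2 := mul_le_mul (hχ1 x) (hv.dist_le_mul x y) dist_nonneg zero_le_one
    have h3 := mul_le_mul (hχ.dist_le_mul x y) (hvM y hy) (norm_nonneg _) (by positivity)
    linarith
  refine LipschitzWith.of_dist_le_mul fun x y => ?_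
  by_cases hy : y ∈ s
  · exact key x y hy
  · by_cases hx : x ∈ s
    · rw [dist_comm, dist_comm x y]
      exact key y x hx
    · rw [hχs x hx, hχs y hy, zero_smul, zero_smul, dist_self]
      positivity

theorem HasFDerivAt.det_eq_zero_of_norm_eq [FiniteDimensional ℝ E] {f : E → E} {f' : E →L[ℝ] E}
    {x : E} {R : ℝ} (hR : 0 < R) (hf : HasFDerivAt f f' x) (hn : ∀ᶠ y in 𝓝 x, ‖f y‖ = R) :
    f'.det = 0 := by
  by_contra hdet
  have h0 : (2 • (innerSL ℝ (f x)).comp f' : E →L[ℝ] ℝ) = 0 := by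
    refine hf.norm_sq.unique ((hasFDerivAt_const (R ^ 2) x).congr_of_eventuallyEq ?_)
    filter_upwards [hn] with y hy using by rw [hy]
  obtain ⟨v, hv⟩ := (f'.toContinuousLinearEquivOfDetNeZero hdet).surjective (f x)
  have h1 := congrArg (fun L : E →L[ℝ] ℝ => L v) h0
  have hv' : f' v = f x := hv
  simp [hv', hn.self_of_nhds, hR.ne'] at h1

variable [FiniteDimensional ℝ E] [MeasurableSpace E] [BorelSpace E]

/-- A Lipschitz self-map of a ball which is the identity outside of it attains the center. -/
theorem LipschitzWith.exists_eq_zero_of_eq_id_outside_ball {K : ℝ≥0} {G : E → E}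
    (hG : LipschitzWith K G) {R : ℝ} (hR : 0 < R) (hout : ∀ x, R ≤ ‖x‖ → G x = x)
    (hin : ∀ x, ‖x‖ < R → ‖G x‖ ≤ R) : ∃ x, G x = 0 := by
  by_contra! hne
  obtain ⟨c, hc, hcG⟩ : ∃ c : ℝ≥0, 0 < c ∧ ∀ x, (c : ℝ) ≤ ‖G x‖ := by
    obtain ⟨x₀, -, hx₀⟩ := (isCompact_closedBall (0 : E) R).exists_isMinOn
      ⟨0, mem_closedBall_self hR.le⟩ hG.continuous.norm.continuousOn
    refine ⟨⟨min ‖G x₀‖ R, le_min (norm_nonneg _) hR.le⟩,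
      lt_min (norm_pos_iff.2 (hne x₀)) hR, fun x => ?_⟩
    rcases le_or_gt ‖x‖ R with h | h
    · exact (min_le_left _ _).trans (hx₀ (mem_closedBall_zero_iff.2 h))
    · rw [hout x h.le]
      exact (min_le_right _ _).trans h.le
  lift R to ℝ≥0 using hR.le
  set r : E → E := fun x => max (R / ‖G x‖) 1 • G x with hr
  obtain ⟨K', hrL⟩ : ∃ K', LipschitzWith K' r :=
    ⟨_, lipschitzOnWith_univ.1 ((lipschitzOnWith_max_div_norm_smul hc).comp hG.lipschitzOnWith
      fun x _ => hcG x)⟩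
  have hrout : ∀ x, (R : ℝ) ≤ ‖x‖ → r x = x := fun x hx => by
    simp only [hr, hout x hx]
    rw [max_eq_right ((div_le_one (hR.trans_le hx)).2 hx), one_smul]
  have hrin : ∀ x ∈ ball (0 : E) R, ‖r x‖ = R := fun x hx => by
    have hGx : 0 < ‖G x‖ := norm_pos_iff.2 (hne x)
    simp only [hr]
    rw [max_eq_left ((one_le_div hGx).2 (hin x (mem_ball_zero_iff.1 hx))), norm_smul,
      Real.norm_of_nonneg (by positivity), div_mul_cancel₀ _ hGx.ne']
  have hint := setIntegral_det_one_add_fderiv (volume : Measure E) (hrL.sub LipschitzWith.id)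
    (measurableSet_ball (x := (0 : E)) (ε := R)) measure_ball_lt_top.ne fun x hx => by
      have : (R : ℝ) ≤ ‖x‖ := by simpa using hx
      simp [hrout x this]
  have hzero : ∫ x in ball (0 : E) R, (1 + fderiv ℝ (fun x => r x - id x) x).det = 0 := by
    refine setIntegral_eq_zero_of_ae_eq_zero ?_
    filter_upwards [hrL.ae_differentiableAt] with x hx hxB
    have hd : fderiv ℝ (fun x => r x - id x) x = fderiv ℝ r x - 1 :=
      (hx.hasFDerivAt.sub (hasFDerivAt_id x)).fderiv
    rw [hd, add_sub_cancel]
    refine hx.hasFDerivAt.det_eq_zero_of_norm_eq hR ?_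
    filter_upwards [isOpen_ball.mem_nhds hxB] using hrin
  have hvol : 0 < (volume : Measure E).real (ball 0 R) :=
    ENNReal.toReal_pos (measure_ball_pos _ _ hR).ne' measure_ball_lt_top.ne
  exact hvol.ne' (hint.symm.trans hzero)

theorem LipschitzWith.image_mem_nhds_zero_of_hasFDerivAt_id {K : ℝ≥0} {g : E → E}
    (hg : LipschitzWith K g) (h0 : g 0 = 0) (hd : HasFDerivAt g (ContinuousLinearMap.id ℝ E) 0)
    {s : Set E} (hs : s ∈ 𝓝 0) : g '' s ∈ 𝓝 0 := by
  have h1 : ∀ᶠ y in 𝓝 (0 : E), ‖g y - y‖ ≤ 1 / 4 * ‖y‖ := by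
    simpa [h0] using hd.isLittleO.bound (by norm_num : (0 : ℝ) < 1 / 4)
  obtain ⟨δ, hδ, hball⟩ := Metric.eventually_nhds_iff_ball.1 (h1.and hs)
  lift δ to ℝ≥0 using hδ.le
  set χ : E → ℝ := fun y => max 0 (min 1 (2 - (2 / δ : ℝ≥0) * ‖y‖)) with hχ
  have hχL : LipschitzWith (2 / δ) χ := by
    refine ((LipschitzWith.of_dist_le_mul fun x y => ?_).const_min 1).const_max 0
    rw [Real.dist_eq, show (2 - (2 / δ : ℝ≥0) * ‖x‖) - (2 - (2 / δ : ℝ≥0) * ‖y‖) =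
      (2 / δ : ℝ≥0) * (‖y‖ - ‖x‖) by ring, abs_mul, NNReal.abs_eq, dist_comm, dist_eq_norm]
    exact mul_le_mul_of_nonneg_left (abs_norm_sub_norm_le _ _) (NNReal.coe_nonneg _)
  have hχ0 : ∀ y, 0 ≤ χ y := fun y => le_max_left _ _
  have hχ1 : ∀ y, χ y ≤ 1 := fun y => max_le zero_le_one (min_le_left _ _)
  have hχout : ∀ y ∉ ball (0 : E) δ, χ y = 0 := fun y hy => by
    have hy' : (δ : ℝ) ≤ ‖y‖ := by simpa using hy
    refine max_eq_left ((min_le_right _ _).trans ?_)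
    have : 2 ≤ 2 / (δ : ℝ) * ‖y‖ := by
      rw [div_mul_eq_mul_div, le_div_iff₀ hδ]; linarith
    push_cast
    linarith
  have hχin : ∀ y, ‖y‖ ≤ δ / 2 → χ y = 1 := fun y hy => by
    have : 2 / (δ : ℝ) * ‖y‖ ≤ 1 := by
      rw [div_mul_eq_mul_div, div_le_iff₀ hδ]; linarith
    simp only [hχ]
    push_cast
    rw [min_eq_left (by linarith), max_eq_right zero_le_one]
  set h : E → E := fun y => χ y • (g y - y) with hh
  have hhL := hχL.smul_of_bounded_on_support (M := δ) (s := ball 0 δ)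
    (hg.sub LipschitzWith.id) (fun y => by rw [abs_of_nonneg (hχ0 y)]; exact hχ1 y) hχout
    fun y hy => by
      have := (hball y hy).1
      have := mem_ball_zero_iff.1 hy
      have := norm_nonneg y
      simp only [id]
      linarith
  have hhb : ∀ y, ‖h y‖ ≤ 1 / 4 * ‖y‖ := fun y => by
    by_cases hy : y ∈ ball (0 : E) δ
    · rw [hh, norm_smul, Real.norm_of_nonneg (hχ0 y)]
      have := mul_le_mul (hχ1 y) (hball y hy).1 (norm_nonneg _) zero_le_one
      linarith
    · simp only [hh, hχout y hy, zero_smul, norm_zero]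
      positivity
  refine Filter.mem_of_superset (ball_mem_nhds 0 (by positivity : (0 : ℝ) < δ / 8)) fun w hw => ?_
  rw [mem_ball_zero_iff] at hw
  obtain ⟨x, hx⟩ := LipschitzWith.exists_eq_zero_of_eq_id_outside_ball
    (G := fun x => x + h (x + w))
    (LipschitzWith.id.add (hhL.comp (LipschitzWith.id.add (LipschitzWith.const w))))
    (R := 2 * δ) (by positivity)
    (fun x hx => by
      have h2 : x + w ∉ ball (0 : E) δ := by
        rw [mem_ball_zero_iff, not_lt]
        have := _root_.norm_sub_le (x + w) w
        rw [add_sub_cancel_right] at this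
        linarith
      simp [hh, hχout _ h2])
    (fun x hx => by
      by_cases h2 : x + w ∈ ball (0 : E) δ
      · have h3 := hhb (x + w)
        have h4 := norm_add_le x (h (x + w))
        have h5 := _root_.norm_sub_le (x + w) w
        rw [add_sub_cancel_right] at h5
        have h6 := mem_ball_zero_iff.1 h2
        linarith
      · simpa [hh, hχout _ h2] using hx.le)
  have hy : x + w + h (x + w) = w := by
    rw [add_right_comm, hx, zero_add]
  have hyn : ‖x + w‖ ≤ δ / 2 := by
    have h2 := _root_.norm_sub_le w (h (x + w))
    rw [← eq_sub_of_add_eq hy] at h2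
    linarith [hhb (x + w)]
  refine ⟨x + w, (hball _ (mem_ball_zero_iff.2 (by linarith))).2, ?_⟩
  simpa [hh, hχin _ hyn] using hy

/-- A Lipschitz map is open at every point where its derivative is invertible. -/
theorem LipschitzWith.image_mem_nhds_of_hasFDerivAt {K : ℝ≥0} {f : E → E} {f' : E →L[ℝ] E}
    {x : E} (hf : LipschitzWith K f) (hd : HasFDerivAt f f' x) (hdet : f'.det ≠ 0)
    {s : Set E} (hs : s ∈ 𝓝 x) : f '' s ∈ 𝓝 (f x) := by
  set e := f'.toContinuousLinearEquivOfDetNeZero hdet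
  set g : E → E := fun y => e.symm (f (x + y) - f x)
  have hgL : LipschitzWith (‖(e.symm : E →L[ℝ] E)‖₊ * (K * (0 + 1) + 0)) g :=
    (e.symm : E →L[ℝ] E).lipschitz.comp
      ((hf.comp ((LipschitzWith.const x).add LipschitzWith.id)).sub (LipschitzWith.const (f x)))
  have hgd : HasFDerivAt g (ContinuousLinearMap.id ℝ E) 0 := by
    have h1 : HasFDerivAt (fun y => f (x + y)) f' 0 :=
      (hasFDerivAt_comp_add_left x).2 (by rwa [add_zero])
    have h2 := (e.symm : E →L[ℝ] E).hasFDerivAt.comp (0 : E) (h1.sub_const (f x))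
    have h3 : ContinuousLinearMap.id ℝ E = (e.symm : E →L[ℝ] E).comp f' :=
      ContinuousLinearMap.ext fun v => (e.symm_apply_apply v).symm
    rw [h3]
    exact h2
  have hs' : (fun y => x + y) ⁻¹' s ∈ 𝓝 (0 : E) :=
    (continuous_const_add x).continuousAt.preimage_mem_nhds (by rwa [add_zero])
  have himg := hgL.image_mem_nhds_zero_of_hasFDerivAt_id (by simp [g]) hgd hs'
  have hφ : Continuous fun z => e.symm (z - f x) := by fun_prop
  refine Filter.mem_of_superset
    (hφ.continuousAt.preimage_mem_nhds (x := f x) (by simpa using himg)) ?_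
  rintro z ⟨y, hy, hyz⟩
  exact ⟨x + y, hy, sub_left_injective (e.symm.injective hyz)⟩

theorem LipschitzWith.volume_image_diff_interior_image {K : ℝ≥0} {f : E → E}
    (hf : LipschitzWith K f) {U : Set E} (hU : IsOpen U) :
    volume (f '' U \ interior (f '' U)) = 0 := by
  set N := {x | ¬DifferentiableAt ℝ f x}
  set Z := {x | DifferentiableAt ℝ f x ∧ (fderiv ℝ f x).det = 0}
  have hN : volume (f '' N) = 0 :=
    hf.lipschitzOnWith.addHaar_image_eq_zero volume hf.ae_differentiableAt
  have hZ : volume (f '' Z) = 0 :=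
    addHaar_image_eq_zero_of_det_fderivWithin_eq_zero volume
      (fun x hx => hx.1.hasFDerivAt.hasFDerivWithinAt) fun x hx => hx.2
  refine measure_mono_null ?_ (measure_union_null hN hZ)
  rintro _ ⟨⟨x, hx, rfl⟩, hxi⟩
  by_cases hdx : DifferentiableAt ℝ f x
  · refine Or.inr ⟨x, ⟨hdx, ?_⟩, rfl⟩
    by_contra hdet
    exact hxi (mem_interior_iff_mem_nhds.2
      (hf.image_mem_nhds_of_hasFDerivAt hdx.hasFDerivAt hdet (hU.mem_nhds hx)))
  · exact Or.inl ⟨x, hdx, rfl⟩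

end Open

section PhiMap
variable {d k : ℕ} {f : Fin k → EuclideanSpace ℝ (Fin d) → EuclideanSpace ℝ (Fin d)}
  {A B D : Set (EuclideanSpace ℝ (Fin d))} {K : Fin k → ℝ≥0}

theorem mem_PhiMap {x : EuclideanSpace ℝ (Fin d)} : x ∈ PhiMap f A ↔ ∃ i, x ∈ f i '' A :=
  mem_iUnion

theorem PhiMap_mono : Monotone (PhiMap f) :=
  fun _ _ h => iUnion_mono fun _ => image_mono h

theorem PhiMap_union : PhiMap f (A ∪ B) = PhiMap f A ∪ PhiMap f B := by
  simp only [PhiMap, image_union, iUnion_union_distrib]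

theorem iterate_PhiMap_union (n : ℕ) :
    (PhiMap f)^[n] (A ∪ B) = (PhiMap f)^[n] A ∪ (PhiMap f)^[n] B := by
  induction n with
  | zero => rfl
  | succ n ih => simp only [Function.iterate_succ_apply', ih, PhiMap_union]

theorem iterate_PhiMap_subset (hAB : A ⊆ B) (hB : ∀ i, f i '' B ⊆ B) (n : ℕ) :
    (PhiMap f)^[n] A ⊆ B := by
  induction n with
  | zero => exact hAB
  | succ n ih =>
    rw [Function.iterate_succ_apply']
    exact (PhiMap_mono ih).trans (iUnion_subset hB)

theorem volume_iterate_PhiMap_eq_zero (hf : ∀ i, LipschitzWith (K i) (f i))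
    (hA : volume A = 0) (n : ℕ) : volume ((PhiMap f)^[n] A) = 0 := by
  induction n with
  | zero => exact hA
  | succ n ih =>
    rw [Function.iterate_succ_apply']
    exact measure_iUnion_null fun i => (hf i).lipschitzOnWith.addHaar_image_eq_zero volume ih

theorem volume_iterate_PhiMap_inter_eq_zero (hf : ∀ i, LipschitzWith (K i) (f i))
    (hinj : ∀ i, Function.Injective (f i)) (hD : ∀ i, f i '' D ⊆ D)
    (hnov : ∀ i j, i ≠ j → volume (f i '' D ∩ f j '' D) = 0)
    (hA : A ⊆ D) (hB : B ⊆ D) (hAB : volume (A ∩ B) = 0) (n : ℕ) :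
    volume ((PhiMap f)^[n] A ∩ (PhiMap f)^[n] B) = 0 := by
  induction n with
  | zero => exact hAB
  | succ n ih =>
    simp only [Function.iterate_succ_apply']
    rw [PhiMap, PhiMap, iUnion_inter]
    refine measure_iUnion_null fun i => ?_
    rw [inter_iUnion]
    refine measure_iUnion_null fun j => ?_
    rcases eq_or_ne i j with rfl | hij
    · rw [← image_inter (hinj i)]
      exact (hf i).lipschitzOnWith.addHaar_image_eq_zero volume ih
    · exact measure_mono_null (inter_subset_inter (image_mono (iterate_PhiMap_subset hA hD n))
        (image_mono (iterate_PhiMap_subset hB hD n))) (hnov i j hij)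

theorem volume_closure_diff_PhiMap_inter_PhiMap_interior (hf : ∀ i, LipschitzWith (K i) (f i)) :
    volume (closure (D \ PhiMap f D) ∩ PhiMap f (interior D)) = 0 := by
  refine measure_mono_null ?_ (measure_iUnion_null fun i =>
    (hf i).volume_image_diff_interior_image (isOpen_interior (s := D)))
  rintro x ⟨hxY, hx⟩
  obtain ⟨i, hi⟩ := mem_PhiMap.1 hx
  refine mem_iUnion.2 ⟨i, hi, fun hxi => ?_⟩
  have hsub : f i '' interior D ⊆ PhiMap f D :=
    (image_mono interior_subset).trans (subset_iUnion (fun i => f i '' D) i)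
  obtain ⟨y, hy, hyD⟩ := mem_closure_iff.1 hxY _ isOpen_interior hxi
  exact hyD.2 (hsub (interior_subset hy))

end PhiMap

/-- For a non-overlapping family of injective contractions mapping `D°` into itself,
with `μ(∂D) = 0` and `Y = closure (D \ Φ(D))`, the sets `Φⁿ(Y)` are pairwise
disjoint in measure. -/
theorem iterates_of_Y_measure_disjoint {d k : ℕ}
    (D : Set (EuclideanSpace ℝ (Fin d))) (hDc : IsCompact D)
    (f : Fin k → EuclideanSpace ℝ (Fin d) → EuclideanSpace ℝ (Fin d))
    (r : Fin k → NNReal) (hf : ∀ i, ContractingWith (r i) (f i))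
    (hinj : ∀ i, Function.Injective (f i))
    (hcont : ∀ i, Continuous (f i))
    (hint : ∀ i, f i '' interior D ⊆ interior D)
    (hnov : ∀ i j, i ≠ j → volume (f i '' D ∩ f j '' D) = 0)
    (hfr : volume (frontier D) = 0) :
    ∀ m n : ℕ, m ≠ n →
      volume ((PhiMap f)^[n] (closure (D \ PhiMap f D)) ∩
        (PhiMap f)^[m] (closure (D \ PhiMap f D))) = 0 := by
  have hL : ∀ i, LipschitzWith (r i) (f i) := fun i => (hf i).toLipschitzWith
  have hnov' : ∀ i j, i ≠ j → volume (f i '' interior D ∩ f j '' interior D) = 0 := fun i j hij =>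
    measure_mono_null (inter_subset_inter (image_mono interior_subset)
      (image_mono interior_subset)) (hnov i j hij)
  set Y := closure (D \ PhiMap f D)
  have hYD : Y ⊆ (Y ∩ interior D) ∪ frontier D := fun x hx => by
    have hxD : x ∈ D := closure_minimal sdiff_subset hDc.isClosed hx
    by_cases hxi : x ∈ interior D
    · exact Or.inl ⟨hx, hxi⟩
    · exact Or.inr ⟨subset_closure hxD, hxi⟩
  have hiter : ∀ n, (PhiMap f)^[n] Y ⊆
      (PhiMap f)^[n] (Y ∩ interior D) ∪ (PhiMap f)^[n] (frontier D) := fun n => by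
    rw [← iterate_PhiMap_union]
    exact PhiMap_mono.iterate n hYD
  have hfrn := volume_iterate_PhiMap_eq_zero hL hfr
  have hlt : ∀ m n, m < n → volume ((PhiMap f)^[n] Y ∩ (PhiMap f)^[m] Y) = 0 := by
    intro m n hmn
    obtain ⟨l, rfl⟩ := Nat.exists_eq_add_of_lt hmn
    have hA : (PhiMap f)^[l + 1] (Y ∩ interior D) ⊆ PhiMap f (interior D) := by
      rw [Function.iterate_succ_apply']
      exact PhiMap_mono (iterate_PhiMap_subset inter_subset_right hint l)
    have hAY : volume ((PhiMap f)^[l + 1] (Y ∩ interior D) ∩ (Y ∩ interior D)) = 0 :=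
      measure_mono_null (fun _ hx => And.intro hx.2.1 (hA hx.1))
        (volume_closure_diff_PhiMap_inter_PhiMap_interior hL)
    have hmain := volume_iterate_PhiMap_inter_eq_zero hL hinj hint hnov'
      (iterate_PhiMap_subset inter_subset_right hint (l + 1))
      inter_subset_right hAY m
    rw [← Function.iterate_add_apply, ← add_assoc] at hmain
    refine measure_mono_null (fun x hx => ?_)
      (measure_union_null hmain (measure_union_null (hfrn (m + l + 1)) (hfrn m)))
    rcases hiter _ hx.1 with h1 | h1
    · rcases hiter _ hx.2 with h2 | h2
      · exact Or.inl ⟨h1, h2⟩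
      · exact Or.inr (Or.inr h2)
    · exact Or.inr (Or.inl h1)
  intro m n hmn
  rcases hmn.lt_or_gt with h | h
  · exact hlt m n h
  · rw [inter_comm]
    exact hlt n m h
end

section
/- For every a ≥ (3 + √5)/2, the equilateral triangle admits a dissection into three similar pieces with area ratio 1 : 1 : a; explicitly, for r ∈ (0, (√5−1)/2], the maps f₁(x,y) = r·R(2π/3)(x,y) + (r,0) and f₂(x,y) = r·R(4π/3)(x,y) + (1 − r/2, r√3/2) admit a dissection of the triangle D with vertices (0,0), (1,0), (1/2, √3/2), and the pieces f₁(X), f₂(X), X have areas in ratio 1 : 1 : (r⁻² − 2). -/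
open MeasureTheory

/-- The equilateral triangle with vertices `(0,0)`, `(1,0)`, `(1/2, √3/2)`. -/
noncomputable def EquilateralTriangle : Set (ℝ × ℝ) :=
  convexHull ℝ {(0, 0), (1, 0), (1 / 2, Real.sqrt 3 / 2)}

/-- `f₁(x,y) = r·R(2π/3)(x,y) + (r,0)`. -/
noncomputable def triMapOne (r : ℝ) : ℝ × ℝ → ℝ × ℝ :=
  fun p => (r * (-(1 / 2) * p.1 - Real.sqrt 3 / 2 * p.2) + r,
    r * (Real.sqrt 3 / 2 * p.1 - 1 / 2 * p.2))

/-- `f₂(x,y) = r·R(4π/3)(x,y) + (1 - r/2, r√3/2)`. -/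
noncomputable def triMapTwo (r : ℝ) : ℝ × ℝ → ℝ × ℝ :=
  fun p => (r * (-(1 / 2) * p.1 + Real.sqrt 3 / 2 * p.2) + (1 - r / 2),
    r * (-(Real.sqrt 3 / 2) * p.1 - 1 / 2 * p.2) + r * Real.sqrt 3 / 2)

/-- A Hutchinson-type iteration on an open set `Z` yields an open subset `E` of `Z` which is
disjoint from its images under `f` and `g` and which, with them, covers almost all of `Z`. -/
theorem exists_isOpen_disjoint_images {α : Type*} [TopologicalSpace α] [MeasurableSpace α]
    (μ : Measure α) (f g : α ≃ₜ α) {Z : Set α} (κ : ENNReal) (hκ : κ + κ < 1) (hZ : IsOpen Z)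
    (hfin : μ Z ≠ ⊤) (hf : ∀ S, μ (f '' S) = κ * μ S) (hg : ∀ S, μ (g '' S) = κ * μ S)
    (hfZ : f '' Z ⊆ Z) (hgZ : g '' Z ⊆ Z) (hfg : Disjoint (f '' Z) (g '' Z))
    (hfr : μ (frontier Z) = 0) :
    ∃ E ⊆ Z, IsOpen E ∧ Disjoint E (f '' E) ∧ Disjoint E (g '' E) ∧
      μ (Z \ (E ∪ f '' E ∪ g '' E)) = 0 := by
  set F : Set α → Set α := fun A => f '' A ∪ g '' A
  set G : Set α := Z \ (closure (f '' Z) ∪ closure (g '' Z))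
  have hsucc : ∀ n, F^[n + 1] G = f '' (F^[n] G) ∪ g '' (F^[n] G) := fun n =>
    Function.iterate_succ_apply' F n G
  have hsub : ∀ n, F^[n] G ⊆ Z := by
    intro n
    induction n with
    | zero => exact Set.sdiff_subset
    | succ n ih =>
      rw [hsucc]
      exact Set.union_subset ((Set.image_mono ih).trans hfZ) ((Set.image_mono ih).trans hgZ)
  have hopen : ∀ n, IsOpen (F^[n] G) := by
    intro n
    induction n with
    | zero => exact hZ.sdiff (isClosed_closure.union isClosed_closure)
    | succ n ih =>
      rw [hsucc]
      exact (f.isOpenMap _ ih).union (g.isOpenMap _ ih)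
  have hdisj : ∀ m k, Disjoint (F^[m] G) (F^[m + k + 1] G) := by
    intro m k
    induction m with
    | zero =>
      rw [hsucc, Set.disjoint_left]
      rintro x ⟨-, hx⟩ (h | h)
      · exact hx (Or.inl (subset_closure (Set.image_mono (hsub _) h)))
      · exact hx (Or.inr (subset_closure (Set.image_mono (hsub _) h)))
    | succ m ih =>
      have e : m + 1 + k + 1 = (m + k + 1) + 1 := by ring
      rw [e, hsucc, hsucc, Set.disjoint_left]
      rw [Set.disjoint_left] at ih hfg
      rintro _ (⟨a, ha, rfl⟩ | ⟨a, ha, rfl⟩) (⟨b, hb, hab⟩ | ⟨b, hb, hab⟩)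
      · exact ih ha (f.injective hab ▸ hb)
      · exact hfg ⟨a, hsub _ ha, rfl⟩ ⟨b, hsub _ hb, hab⟩
      · exact hfg ⟨b, hsub _ hb, hab⟩ ⟨a, hsub _ ha, rfl⟩
      · exact ih ha (g.injective hab ▸ hb)
  have hparity : ∀ n m, Disjoint (F^[2 * n] G) (F^[2 * m + 1] G) := by
    intro n m
    rcases le_or_gt n m with h | h
    · obtain ⟨k, rfl⟩ := Nat.exists_eq_add_of_le h
      have := hdisj (2 * n) (2 * k)
      rwa [show 2 * n + 2 * k + 1 = 2 * (n + k) + 1 by ring] at this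
    · obtain ⟨k, rfl⟩ := Nat.exists_eq_add_of_lt h
      have := (hdisj (2 * m + 1) (2 * k)).symm
      rwa [show 2 * m + 1 + 2 * k + 1 = 2 * (m + k + 1) by ring] at this
  have hfE : ∀ m, f '' (F^[m] G) ⊆ F^[m + 1] G := fun m => hsucc m ▸ Set.subset_union_left
  have hgE : ∀ m, g '' (F^[m] G) ⊆ F^[m + 1] G := fun m => hsucc m ▸ Set.subset_union_right
  refine ⟨⋃ n, F^[2 * n] G, Set.iUnion_subset fun n => hsub _, isOpen_iUnion fun n => hopen _,
    ?_, ?_, ?_⟩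
  · rw [Set.image_iUnion, Set.disjoint_iUnion_left]
    intro n
    rw [Set.disjoint_iUnion_right]
    exact fun m => (hparity n m).mono_right (hfE _)
  · rw [Set.image_iUnion, Set.disjoint_iUnion_left]
    intro n
    rw [Set.disjoint_iUnion_right]
    exact fun m => (hparity n m).mono_right (hgE _)
  set E : Set α := ⋃ n, F^[2 * n] G
  have hcover : ∀ n, F^[n] G ⊆ E ∪ f '' E ∪ g '' E := by
    intro n
    obtain ⟨k, rfl | rfl⟩ := n.even_or_odd'
    · exact fun x hx => Or.inl (Or.inl (Set.mem_iUnion.2 ⟨k, hx⟩))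
    · rw [hsucc]
      have hk : F^[2 * k] G ⊆ E := Set.subset_iUnion (fun n => F^[2 * n] G) k
      exact Set.union_subset
        (fun x hx => Or.inl (Or.inr (Set.image_mono hk hx)))
        (fun x hx => Or.inr (Set.image_mono hk hx))
  set R : Set α := Z \ ⋃ n, F^[n] G
  refine measure_mono_null
    (t := R) (Set.sdiff_subset_sdiff_right (Set.iUnion_subset hcover)) ?_
  have hRsub : R ⊆ (f '' frontier Z ∪ g '' frontier Z) ∪ (f '' R ∪ g '' R) := by
    rintro x ⟨hxZ, hx⟩
    have key : ∀ h : α ≃ₜ α, (∀ m, h '' (F^[m] G) ⊆ F^[m + 1] G) → x ∈ closure (h '' Z) →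
        x ∈ h '' frontier Z ∨ x ∈ h '' R := by
      intro h hh hxc
      rw [← h.image_closure] at hxc
      obtain ⟨z, hz, rfl⟩ := hxc
      by_cases hzZ : z ∈ Z
      · refine Or.inr ⟨z, ⟨hzZ, fun hzG => hx ?_⟩, rfl⟩
        obtain ⟨n, hn⟩ := Set.mem_iUnion.1 hzG
        exact Set.mem_iUnion.2 ⟨n + 1, hh n ⟨z, hn, rfl⟩⟩
      · exact Or.inl ⟨z, ⟨hz, fun hi => hzZ (interior_subset hi)⟩, rfl⟩
    by_cases hxc : x ∈ closure (f '' Z) ∪ closure (g '' Z)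
    · rcases hxc with hxc | hxc
      · exact (key f hfE hxc).imp Or.inl Or.inl
      · exact (key g hgE hxc).imp Or.inr Or.inr
    · have hxG : x ∈ F^[0] G := ⟨hxZ, hxc⟩
      exact absurd (Set.mem_iUnion.2 ⟨0, hxG⟩) hx
  have hle : μ R ≤ (κ + κ) * μ R := by
    refine (measure_mono hRsub).trans ((measure_union_le _ _).trans ?_)
    have h0 : μ (f '' frontier Z ∪ g '' frontier Z) = 0 := by
      rw [measure_union_null_iff, hf, hg, hfr]
      simp
    rw [h0, zero_add]
    exact (measure_union_le _ _).trans_eq (by rw [hf, hg, add_mul])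
  by_contra hne
  have hRfin : μ R ≠ ⊤ := measure_ne_top_of_subset Set.sdiff_subset hfin
  have := ENNReal.mul_lt_mul_left hne hRfin hκ
  rw [one_mul] at this
  exact absurd hle (not_le.2 this)

/-- The closure of an open set which together with its two images tiles almost all of `D`
provides a dissection of `D`. -/
theorem dissection_closure {α : Type*} [TopologicalSpace α] [MeasurableSpace α]
    (μ : Measure α) [μ.IsOpenPosMeasure] (f g : α ≃ₜ α) {D U : Set α} (hD : IsClosed D)
    (hDreg : D ⊆ closure (interior D)) (hU : IsOpen U) (hUD : U ⊆ D) (hfD : f '' D ⊆ D)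
    (hgD : g '' D ⊆ D) (hUf : Disjoint U (f '' U)) (hUg : Disjoint U (g '' U))
    (hfg : Disjoint (f '' U) (g '' U)) (hnull : μ (D \ (U ∪ f '' U ∪ g '' U)) = 0) :
    D = closure U ∪ f '' closure U ∪ g '' closure U ∧
      μ (closure U ∩ f '' closure U) = 0 ∧ μ (closure U ∩ g '' closure U) = 0 ∧
      μ (f '' closure U ∩ g '' closure U) = 0 := by
  have hfU : IsOpen (f '' U) := f.isOpenMap _ hU
  have hgU : IsOpen (g '' U) := g.isOpenMap _ hU
  have hcU : closure U ⊆ D := closure_minimal hUD hD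
  have hcf : closure (f '' U) ⊆ D := closure_minimal ((Set.image_mono hUD).trans hfD) hD
  have hcg : closure (g '' U) ⊆ D := closure_minimal ((Set.image_mono hUD).trans hgD) hD
  rw [f.image_closure, g.image_closure]
  have sep : ∀ {A B : Set α}, IsOpen A → IsOpen B → Disjoint A B → closure A ⊆ D →
      closure A ∩ closure B ⊆ D \ (A ∪ B) := by
    rintro A B hA hB hAB hAD x ⟨hxA, hxB⟩
    refine ⟨hAD hxA, ?_⟩
    rintro (h | h)
    · exact Set.disjoint_left.1 (hAB.closure_right hA) h hxB
    · exact Set.disjoint_left.1 (hAB.closure_left hB) hxA h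
  have null : ∀ {A B C : Set α}, IsOpen A → IsOpen B → IsOpen C → Disjoint A B → Disjoint A C →
      closure A ⊆ D → μ (D \ (A ∪ B ∪ C)) = 0 → μ (closure A ∩ closure B) = 0 := by
    intro A B C hA hB hC hAB hAC hAD h
    refine measure_mono_null (fun x hx => ?_) h
    obtain ⟨hxD, hxAB⟩ := sep hA hB hAB hAD hx
    exact ⟨hxD, fun h => h.elim hxAB fun hxC =>
      Set.disjoint_left.1 (hAC.closure_left hC) hx.1 hxC⟩
  refine ⟨Set.Subset.antisymm ?_ (Set.union_subset (Set.union_subset hcU hcf) hcg),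
    null hU hfU hgU hUf hUg hcU hnull,
    null hU hgU hfU hUg hUf hcU (by rwa [Set.union_right_comm]),
    null hfU hgU hU hfg hUf.symm hcf (by rwa [Set.union_right_comm, Set.union_comm _ U])⟩
  have hclosed : IsClosed (closure U ∪ closure (f '' U) ∪ closure (g '' U)) :=
    (isClosed_closure.union isClosed_closure).union isClosed_closure
  refine hDreg.trans (closure_minimal ?_ hclosed)
  rw [← Set.sdiff_eq_empty]
  refine (isOpen_interior.sdiff hclosed).measure_eq_zero_iff μ |>.1 (measure_mono_null ?_ hnull)
  refine Set.sdiff_subset_sdiff interior_subset ?_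
  exact Set.union_subset_union (Set.union_subset_union subset_closure subset_closure)
    subset_closure

/-- The barycentric coordinate with respect to `(1, 0)`. -/
noncomputable def baryRight (p : ℝ × ℝ) : ℝ := p.1 - Real.sqrt 3 / 3 * p.2

/-- The barycentric coordinate with respect to `(1/2, √3/2)`. -/
noncomputable def baryTop (p : ℝ × ℝ) : ℝ := 2 * Real.sqrt 3 / 3 * p.2

/-- The barycentric coordinate with respect to `(0, 0)`. -/
noncomputable def baryLeft (p : ℝ × ℝ) : ℝ := 1 - p.1 - Real.sqrt 3 / 3 * p.2

theorem baryLeft_eq (p : ℝ × ℝ) : baryLeft p = 1 - baryRight p - baryTop p := by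
  unfold baryLeft baryRight baryTop; ring

theorem sqrt_three_mul_self : Real.sqrt 3 * Real.sqrt 3 = 3 := Real.mul_self_sqrt (by norm_num)

theorem baryRight_triMapOne (r : ℝ) (p : ℝ × ℝ) :
    baryRight (triMapOne r p) = r * baryLeft p := by
  simp only [baryRight, baryLeft, triMapOne]
  linear_combination (-(r * p.1 / 6)) * sqrt_three_mul_self

theorem baryTop_triMapOne (r : ℝ) (p : ℝ × ℝ) :
    baryTop (triMapOne r p) = r * baryRight p := by
  simp only [baryTop, baryRight, triMapOne]
  linear_combination (r * p.1 / 3) * sqrt_three_mul_self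

theorem baryRight_triMapTwo (r : ℝ) (p : ℝ × ℝ) :
    baryRight (triMapTwo r p) = 1 - r + r * baryTop p := by
  simp only [baryRight, baryTop, triMapTwo]
  linear_combination (r * p.1 / 6 - r / 6) * sqrt_three_mul_self

theorem baryTop_triMapTwo (r : ℝ) (p : ℝ × ℝ) :
    baryTop (triMapTwo r p) = r * baryLeft p := by
  simp only [baryTop, baryLeft, triMapTwo]
  linear_combination (- r * p.1 / 3 + r / 3) * sqrt_three_mul_self

@[fun_prop]
theorem continuous_baryRight : Continuous baryRight := by unfold baryRight; fun_prop

@[fun_prop]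
theorem continuous_baryTop : Continuous baryTop := by unfold baryTop; fun_prop

@[fun_prop]
theorem continuous_baryLeft : Continuous baryLeft := by unfold baryLeft; fun_prop

/-- The point with barycentric coordinates `1 - u - v, u, v`. -/
noncomputable def ofBary (u v : ℝ) : ℝ × ℝ := (u + v / 2, Real.sqrt 3 / 2 * v)

theorem ofBary_bary (p : ℝ × ℝ) : ofBary (baryRight p) (baryTop p) = p := by
  simp only [ofBary, baryRight, baryTop]
  ext
  · ring
  · linear_combination (p.2 / 3) * sqrt_three_mul_self

theorem baryRight_ofBary (u v : ℝ) : baryRight (ofBary u v) = u := by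
  simp only [ofBary, baryRight]
  linear_combination (-(v / 6)) * sqrt_three_mul_self

theorem baryTop_ofBary (u v : ℝ) : baryTop (ofBary u v) = v := by
  simp only [ofBary, baryTop]
  linear_combination (v / 3) * sqrt_three_mul_self

theorem ext_bary {p q : ℝ × ℝ} (h₁ : baryRight p = baryRight q) (h₂ : baryTop p = baryTop q) :
    p = q := by
  rw [← ofBary_bary p, ← ofBary_bary q, h₁, h₂]

theorem continuous_ofBary : Continuous fun q : ℝ × ℝ => ofBary q.1 q.2 := by
  unfold ofBary; fun_prop

/-- `triMapOne r` as a homeomorphism. -/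
noncomputable def triHomeoOne (r : ℝ) (hr : 0 < r) : ℝ × ℝ ≃ₜ ℝ × ℝ where
  toFun := triMapOne r
  invFun q := ofBary (baryTop q / r) (1 - baryTop q / r - baryRight q / r)
  left_inv p := by
    apply ext_bary
    · rw [baryRight_ofBary, baryTop_triMapOne]
      field_simp
    · rw [baryTop_ofBary, baryTop_triMapOne, baryRight_triMapOne, baryLeft_eq]
      field_simp
      ring
  right_inv q := by
    apply ext_bary
    · rw [baryRight_triMapOne, baryLeft_eq, baryRight_ofBary, baryTop_ofBary]
      field_simp
      ring
    · rw [baryTop_triMapOne, baryRight_ofBary]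
      field_simp
  continuous_toFun := by unfold triMapOne; fun_prop
  continuous_invFun := continuous_ofBary.comp (by fun_prop : Continuous fun q : ℝ × ℝ =>
    (baryTop q / r, 1 - baryTop q / r - baryRight q / r))

/-- `triMapTwo r` as a homeomorphism. -/
noncomputable def triHomeoTwo (r : ℝ) (hr : 0 < r) : ℝ × ℝ ≃ₜ ℝ × ℝ where
  toFun := triMapTwo r
  invFun q := ofBary (baryLeft q / r) ((baryRight q - 1 + r) / r)
  left_inv p := by
    apply ext_bary
    · rw [baryRight_ofBary, baryLeft_eq, baryTop_triMapTwo, baryRight_triMapTwo, baryLeft_eq]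
      field_simp
      ring
    · rw [baryTop_ofBary, baryRight_triMapTwo]
      field_simp
      ring
  right_inv q := by
    apply ext_bary
    · rw [baryRight_triMapTwo, baryTop_ofBary]
      field_simp
      ring
    · rw [baryTop_triMapTwo, baryLeft_eq, baryRight_ofBary, baryTop_ofBary, baryLeft_eq]
      field_simp
      ring
  continuous_toFun := by unfold triMapTwo; fun_prop
  continuous_invFun := continuous_ofBary.comp (by fun_prop : Continuous fun q : ℝ × ℝ =>
    (baryLeft q / r, (baryRight q - 1 + r) / r))

/-- Area scaling for a planar affine map with linear part `!![a, b; c, d]`. -/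
theorem volume_image_affine (a b c d s t : ℝ) (S : Set (ℝ × ℝ)) :
    volume ((fun p : ℝ × ℝ => (a * p.1 + b * p.2 + s, c * p.1 + d * p.2 + t)) '' S) =
      ENNReal.ofReal |a * d - b * c| * volume S := by
  have h : (fun p : ℝ × ℝ => (a * p.1 + b * p.2 + s, c * p.1 + d * p.2 + t)) =
      (fun p => p + (s, t)) ∘
        Matrix.toLin (Module.Basis.finTwoProd ℝ) (Module.Basis.finTwoProd ℝ) !![a, b; c, d] := by
    funext p
    simp [Matrix.toLin_finTwoProd_apply]
  rw [h, Set.image_comp, Set.image_add_right, measure_preimage_add_right,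
    Measure.addHaar_image_linearMap, LinearMap.det_toLin, Matrix.det_fin_two_of]

theorem volume_triMapOne_image (r : ℝ) (S : Set (ℝ × ℝ)) :
    volume (triMapOne r '' S) = ENNReal.ofReal (r ^ 2) * volume S := by
  have h : triMapOne r = fun p : ℝ × ℝ => (-(r / 2) * p.1 + -(r * Real.sqrt 3 / 2) * p.2 + r,
      r * Real.sqrt 3 / 2 * p.1 + -(r / 2) * p.2 + 0) := by
    funext p
    simp only [triMapOne, Prod.mk.injEq]
    constructor <;> ring
  rw [h, volume_image_affine, ← abs_of_nonneg (sq_nonneg r)]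
  congr 3
  linear_combination (r ^ 2 / 4) * sqrt_three_mul_self

theorem volume_triMapTwo_image (r : ℝ) (S : Set (ℝ × ℝ)) :
    volume (triMapTwo r '' S) = ENNReal.ofReal (r ^ 2) * volume S := by
  have h : triMapTwo r = fun p : ℝ × ℝ =>
      (-(r / 2) * p.1 + r * Real.sqrt 3 / 2 * p.2 + (1 - r / 2),
      -(r * Real.sqrt 3 / 2) * p.1 + -(r / 2) * p.2 + r * Real.sqrt 3 / 2) := by
    funext p
    simp only [triMapTwo, Prod.mk.injEq]
    constructor <;> ring
  rw [h, volume_image_affine, ← abs_of_nonneg (sq_nonneg r)]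
  congr 3
  linear_combination (r ^ 2 / 4) * sqrt_three_mul_self

theorem volume_line_eq_zero (a b k : ℝ) (hb : b ≠ 0) :
    volume {p : ℝ × ℝ | a * p.1 + b * p.2 = k} = 0 := by
  have hm : MeasurableSet {p : ℝ × ℝ | a * p.1 + b * p.2 = k} :=
    (isClosed_eq (by fun_prop) continuous_const).measurableSet
  rw [Measure.volume_eq_prod, Measure.measure_prod_null hm]
  refine Filter.Eventually.of_forall fun x => Set.Subsingleton.measure_zero ?_ _
  intro y hy z hz
  simp only [Set.mem_preimage, Set.mem_ofPred_eq] at hy hz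
  exact mul_left_cancel₀ hb (by linarith)

theorem volume_baryRight_eq (k : ℝ) : volume {p | baryRight p = k} = 0 := by
  convert volume_line_eq_zero 1 (-(Real.sqrt 3 / 3)) k (by simp) using 3
  funext p
  unfold baryRight
  exact propext ⟨fun h => by linarith, fun h => by linarith⟩

theorem volume_baryTop_eq (k : ℝ) : volume {p | baryTop p = k} = 0 := by
  convert volume_line_eq_zero 0 (2 * Real.sqrt 3 / 3) k (by simp) using 3
  funext p
  unfold baryTop
  exact propext ⟨fun h => by linarith, fun h => by linarith⟩

theorem volume_baryLeft_eq (k : ℝ) : volume {p | baryLeft p = k} = 0 := by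
  convert volume_line_eq_zero (-1) (-(Real.sqrt 3 / 3)) (k - 1) (by simp) using 3
  funext p
  unfold baryLeft
  exact propext ⟨fun h => by linarith, fun h => by linarith⟩

theorem mem_equilateralTriangle {p : ℝ × ℝ} :
    p ∈ EquilateralTriangle ↔ 0 ≤ baryLeft p ∧ 0 ≤ baryRight p ∧ 0 ≤ baryTop p := by
  constructor
  · intro hp
    have hconv : Convex ℝ {p : ℝ × ℝ | 0 ≤ baryLeft p ∧ 0 ≤ baryRight p ∧ 0 ≤ baryTop p} := by
      rintro x ⟨hx₁, hx₂, hx₃⟩ y ⟨hy₁, hy₂, hy₃⟩ a b ha hb hab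
      simp only [Set.mem_ofPred_eq]
      refine ⟨?_, ?_, ?_⟩
      · have e : baryLeft (a • x + b • y) = a * baryLeft x + b * baryLeft y := by
          simp only [baryLeft, Prod.fst_add, Prod.snd_add, Prod.smul_fst, Prod.smul_snd,
            smul_eq_mul]
          linear_combination -hab
        rw [e]; positivity
      · have e : baryRight (a • x + b • y) = a * baryRight x + b * baryRight y := by
          simp only [baryRight, Prod.fst_add, Prod.snd_add, Prod.smul_fst, Prod.smul_snd,
            smul_eq_mul]
          ring
        rw [e]; positivity
      · have e : baryTop (a • x + b • y) = a * baryTop x + b * baryTop y := by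
          simp only [baryTop, Prod.snd_add, Prod.smul_snd, smul_eq_mul]
          ring
        rw [e]; positivity
    refine convexHull_min ?_ hconv hp
    have h3 := sqrt_three_mul_self
    rintro q (rfl | rfl | rfl) <;> simp only [baryLeft, baryRight, baryTop, Set.mem_ofPred_eq] <;>
      refine ⟨?_, ?_, ?_⟩ <;> nlinarith
  · rintro ⟨h₁, h₂, h₃⟩
    have hsub := subset_convexHull ℝ ({(0, 0), (1, 0), (1 / 2, Real.sqrt 3 / 2)} : Set (ℝ × ℝ))
    have h := (convex_convexHull ℝ
      ({(0, 0), (1, 0), (1 / 2, Real.sqrt 3 / 2)} : Set (ℝ × ℝ))).sum_mem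
      (t := Finset.univ) (w := ![baryLeft p, baryRight p, baryTop p])
      (z := ![(0, 0), (1, 0), (1 / 2, Real.sqrt 3 / 2)])
      (by intro i _; fin_cases i <;> simpa)
      (by simpa [Fin.sum_univ_three] using by linarith [baryLeft_eq p])
      (by intro i _; apply hsub; fin_cases i <;> simp)
    have e : ∑ i, ![baryLeft p, baryRight p, baryTop p] i •
        (![(0, 0), (1, 0), (1 / 2, Real.sqrt 3 / 2)] : Fin 3 → ℝ × ℝ) i = p := by
      conv_rhs => rw [← ofBary_bary p]
      simp [Fin.sum_univ_three, ofBary]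
      constructor <;> ring
    rwa [e] at h

theorem isCompact_equilateralTriangle : IsCompact EquilateralTriangle :=
  (Set.toFinite _).isCompact_convexHull ℝ

theorem subset_closure_interior_equilateralTriangle :
    EquilateralTriangle ⊆ closure (interior EquilateralTriangle) := by
  have hconv : Convex ℝ EquilateralTriangle := convex_convexHull ℝ _
  have hopen : IsOpen {p : ℝ × ℝ | 0 < baryLeft p ∧ 0 < baryRight p ∧ 0 < baryTop p} :=
    (isOpen_lt continuous_const continuous_baryLeft).inter
      ((isOpen_lt continuous_const continuous_baryRight).inter
        (isOpen_lt continuous_const continuous_baryTop))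
  have hne : (interior EquilateralTriangle).Nonempty := by
    refine ⟨ofBary (1 / 3) (1 / 3), interior_maximal (fun p hp =>
      mem_equilateralTriangle.2 ⟨hp.1.le, hp.2.1.le, hp.2.2.le⟩) hopen ?_⟩
    simp only [Set.mem_ofPred_eq, baryLeft_eq, baryRight_ofBary, baryTop_ofBary]
    norm_num
  rw [hconv.closure_interior_eq_closure_of_nonempty_interior hne]
  exact subset_closure

/-- The open corner of the triangle at `(1/2, √3/2)` cut off at barycentric height `c`. -/
def topCorner (c : ℝ) : Set (ℝ × ℝ) :=
  {p | c < baryTop p ∧ 0 < baryLeft p ∧ 0 < baryRight p}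

/-- The open trapezoid left in the triangle by three corners, the lower two of size `c` and the
upper one of size `1 - c`. -/
def midTrapezoid (c : ℝ) : Set (ℝ × ℝ) :=
  {p | (0 < baryTop p ∧ baryTop p < c) ∧ baryLeft p < 1 - c ∧ baryRight p < 1 - c}

theorem isOpen_topCorner (c : ℝ) : IsOpen (topCorner c) :=
  (isOpen_lt continuous_const continuous_baryTop).inter
    ((isOpen_lt continuous_const continuous_baryLeft).inter
      (isOpen_lt continuous_const continuous_baryRight))

theorem isOpen_midTrapezoid (c : ℝ) : IsOpen (midTrapezoid c) :=
  ((isOpen_lt continuous_const continuous_baryTop).inter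
    (isOpen_lt continuous_baryTop continuous_const)).inter
    ((isOpen_lt continuous_baryLeft continuous_const).inter
      (isOpen_lt continuous_baryRight continuous_const))

theorem volume_frontier_midTrapezoid (c : ℝ) : volume (frontier (midTrapezoid c)) = 0 := by
  have hsub : frontier (midTrapezoid c) ⊆ ({p | baryTop p = 0} ∪ {p | baryTop p = c}) ∪
      ({p | baryLeft p = 1 - c} ∪ {p | baryRight p = 1 - c}) := by
    intro p hp
    have hcl : closure (midTrapezoid c) ⊆ {p | (0 ≤ baryTop p ∧ baryTop p ≤ c) ∧
        baryLeft p ≤ 1 - c ∧ baryRight p ≤ 1 - c} :=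
      closure_minimal (fun q hq => ⟨⟨hq.1.1.le, hq.1.2.le⟩, hq.2.1.le, hq.2.2.le⟩)
        (((isClosed_le continuous_const continuous_baryTop).inter
          (isClosed_le continuous_baryTop continuous_const)).inter
          ((isClosed_le continuous_baryLeft continuous_const).inter
            (isClosed_le continuous_baryRight continuous_const)))
    rw [(isOpen_midTrapezoid c).frontier_eq] at hp
    obtain ⟨⟨h₁, h₂⟩, h₃, h₄⟩ := hcl hp.1
    by_contra hn
    simp only [Set.mem_union, Set.mem_ofPred_eq, not_or] at hn
    obtain ⟨⟨n₁, n₂⟩, n₃, n₄⟩ := hn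
    exact hp.2 ⟨⟨lt_of_le_of_ne h₁ (Ne.symm n₁), lt_of_le_of_ne h₂ n₂⟩, lt_of_le_of_ne h₃ n₃,
      lt_of_le_of_ne h₄ n₄⟩
  exact measure_mono_null hsub (measure_union_null
    (measure_union_null (volume_baryTop_eq _) (volume_baryTop_eq _))
    (measure_union_null (volume_baryLeft_eq _) (volume_baryRight_eq _)))

theorem topCorner_subset {c : ℝ} (hc : 0 ≤ c) : topCorner c ⊆ EquilateralTriangle :=
  fun _ hp => mem_equilateralTriangle.2 ⟨hp.2.1.le, hp.2.2.le, hc.trans hp.1.le⟩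

theorem midTrapezoid_subset (c : ℝ) : midTrapezoid c ⊆ EquilateralTriangle := by
  rintro p ⟨⟨h₁, h₂⟩, h₃, h₄⟩
  have := baryLeft_eq p
  exact mem_equilateralTriangle.2 ⟨by linarith, by linarith, h₁.le⟩

theorem baryLeft_triMapOne (r : ℝ) (p : ℝ × ℝ) :
    baryLeft (triMapOne r p) = 1 - r + r * baryTop p := by
  rw [baryLeft_eq, baryRight_triMapOne, baryTop_triMapOne, baryLeft_eq]; ring

theorem baryLeft_triMapTwo (r : ℝ) (p : ℝ × ℝ) :
    baryLeft (triMapTwo r p) = r * baryRight p := by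
  rw [baryLeft_eq, baryRight_triMapTwo, baryTop_triMapTwo, baryLeft_eq]; ring

theorem triMapOne_image_subset {r : ℝ} (hr : 0 ≤ r) (hr' : r ≤ 1) :
    triMapOne r '' EquilateralTriangle ⊆ EquilateralTriangle := by
  rintro _ ⟨p, hp, rfl⟩
  rw [mem_equilateralTriangle] at hp ⊢
  obtain ⟨h₁, h₂, h₃⟩ := hp
  rw [baryLeft_triMapOne, baryRight_triMapOne, baryTop_triMapOne]
  have := mul_nonneg hr h₃
  exact ⟨by linarith, by positivity, by positivity⟩

theorem triMapTwo_image_subset {r : ℝ} (hr : 0 ≤ r) (hr' : r ≤ 1) :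
    triMapTwo r '' EquilateralTriangle ⊆ EquilateralTriangle := by
  rintro _ ⟨p, hp, rfl⟩
  rw [mem_equilateralTriangle] at hp ⊢
  obtain ⟨h₁, h₂, h₃⟩ := hp
  rw [baryLeft_triMapTwo, baryRight_triMapTwo, baryTop_triMapTwo]
  have := mul_nonneg hr h₃
  exact ⟨by positivity, by linarith, by positivity⟩

theorem triMapOne_image_midTrapezoid {r c : ℝ} (hr : 0 < r) (hc : r * (1 - c) = c)
    (hc' : c < 1 / 2) : triMapOne r '' midTrapezoid c ⊆ midTrapezoid c := by
  rintro _ ⟨p, ⟨⟨h₁, h₂⟩, h₃, h₄⟩, rfl⟩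
  have hR : 0 < baryRight p := by linarith [baryLeft_eq p]
  simp only [midTrapezoid, Set.mem_ofPred_eq, baryLeft_triMapOne, baryRight_triMapOne,
    baryTop_triMapOne]
  exact ⟨⟨by positivity, by nlinarith⟩, by nlinarith, by nlinarith⟩

theorem triMapTwo_image_midTrapezoid {r c : ℝ} (hr : 0 < r) (hc : r * (1 - c) = c)
    (hc' : c < 1 / 2) : triMapTwo r '' midTrapezoid c ⊆ midTrapezoid c := by
  rintro _ ⟨p, ⟨⟨h₁, h₂⟩, h₃, h₄⟩, rfl⟩
  have hL : 0 < baryLeft p := by linarith [baryLeft_eq p]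
  simp only [midTrapezoid, Set.mem_ofPred_eq, baryLeft_triMapTwo, baryRight_triMapTwo,
    baryTop_triMapTwo]
  exact ⟨⟨by positivity, by nlinarith⟩, by nlinarith, by nlinarith⟩

theorem disjoint_images_midTrapezoid {r c : ℝ} (hr : 0 < r) (hc : r * (1 - c) = c)
    (hrc : c ≤ 1 - r) :
    Disjoint (triMapOne r '' midTrapezoid c) (triMapTwo r '' midTrapezoid c) := by
  rw [Set.disjoint_left]
  rintro _ ⟨p, ⟨-, h₃, -⟩, rfl⟩ ⟨q, ⟨⟨h₁, -⟩, -⟩, h⟩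
  have h := congrArg baryRight h
  rw [baryRight_triMapTwo, baryRight_triMapOne] at h
  nlinarith [mul_pos hr h₁]

theorem triMapOne_image_topCorner {r c : ℝ} (hr : 0 < r) (hc : r * (1 - c) = c) :
    triMapOne r '' topCorner c =
      {p | 1 - c < baryLeft p ∧ 0 < baryRight p ∧ 0 < baryTop p} := by
  ext p
  constructor
  · rintro ⟨p, ⟨h₁, h₂, h₃⟩, rfl⟩
    simp only [Set.mem_ofPred_eq, baryLeft_triMapOne, baryRight_triMapOne, baryTop_triMapOne]
    exact ⟨by nlinarith, by positivity, by positivity⟩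
  · intro hp
    obtain ⟨q, rfl⟩ := (triHomeoOne r hr).surjective p
    change triMapOne r q ∈ _ at hp
    simp only [Set.mem_ofPred_eq, baryLeft_triMapOne, baryRight_triMapOne, baryTop_triMapOne,
      mul_pos_iff_of_pos_left hr] at hp
    exact ⟨q, ⟨lt_of_mul_lt_mul_left (by linarith [hp.1]) hr.le, hp.2⟩, rfl⟩

theorem triMapTwo_image_topCorner {r c : ℝ} (hr : 0 < r) (hc : r * (1 - c) = c) :
    triMapTwo r '' topCorner c =
      {p | 1 - c < baryRight p ∧ 0 < baryTop p ∧ 0 < baryLeft p} := by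
  ext p
  constructor
  · rintro ⟨p, ⟨h₁, h₂, h₃⟩, rfl⟩
    simp only [Set.mem_ofPred_eq, baryLeft_triMapTwo, baryRight_triMapTwo, baryTop_triMapTwo]
    exact ⟨by nlinarith, by positivity, by positivity⟩
  · intro hp
    obtain ⟨q, rfl⟩ := (triHomeoTwo r hr).surjective p
    change triMapTwo r q ∈ _ at hp
    simp only [Set.mem_ofPred_eq, baryLeft_triMapTwo, baryRight_triMapTwo, baryTop_triMapTwo,
      mul_pos_iff_of_pos_left hr] at hp
    exact ⟨q, ⟨lt_of_mul_lt_mul_left (by linarith [hp.1]) hr.le, hp.2⟩, rfl⟩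

theorem volume_triangle_diff_corners {r c : ℝ} (hr : 0 < r) (hc : r * (1 - c) = c) :
    volume (EquilateralTriangle \ (topCorner c ∪ triMapOne r '' topCorner c ∪
      triMapTwo r '' topCorner c ∪ midTrapezoid c)) = 0 := by
  rw [triMapOne_image_topCorner hr hc, triMapTwo_image_topCorner hr hc]
  have hsub : EquilateralTriangle \ (topCorner c ∪
      {p | 1 - c < baryLeft p ∧ 0 < baryRight p ∧ 0 < baryTop p} ∪
      {p | 1 - c < baryRight p ∧ 0 < baryTop p ∧ 0 < baryLeft p} ∪ midTrapezoid c) ⊆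
      (({p | baryTop p = 0} ∪ {p | baryTop p = c}) ∪
        ({p | baryLeft p = 0} ∪ {p | baryLeft p = 1 - c})) ∪
      ({p | baryRight p = 0} ∪ {p | baryRight p = 1 - c}) := by
    rintro p ⟨hp, hn⟩
    obtain ⟨h₁, h₂, h₃⟩ := mem_equilateralTriangle.1 hp
    by_contra hl
    simp only [Set.mem_union, Set.mem_ofPred_eq, not_or, topCorner, midTrapezoid] at hl hn
    obtain ⟨⟨⟨l₁, l₂⟩, l₃, l₄⟩, l₅, l₆⟩ := hl
    obtain ⟨⟨⟨n₁, n₂⟩, n₃⟩, n₄⟩ := hn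
    replace h₁ := lt_of_le_of_ne h₁ (Ne.symm l₃)
    replace h₂ := lt_of_le_of_ne h₂ (Ne.symm l₅)
    replace h₃ := lt_of_le_of_ne h₃ (Ne.symm l₁)
    refine n₄ ⟨⟨h₃, lt_of_le_of_ne (not_lt.1 fun h => n₁ ⟨h, h₁, h₂⟩) l₂⟩,
      lt_of_le_of_ne (not_lt.1 fun h => n₂ ⟨h, h₂, h₃⟩) l₄,
      lt_of_le_of_ne (not_lt.1 fun h => n₃ ⟨h, h₃, h₁⟩) l₆⟩
  exact measure_mono_null hsub (measure_union_null (measure_union_null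
    (measure_union_null (volume_baryTop_eq _) (volume_baryTop_eq _))
    (measure_union_null (volume_baryLeft_eq _) (volume_baryLeft_eq _)))
    (measure_union_null (volume_baryRight_eq _) (volume_baryRight_eq _)))

/-- For `r² + r ≤ 1` some open subset of the triangle and its images under the two maps are
disjoint and fill the triangle up to a null set. -/
theorem exists_isOpen_tiling {r : ℝ} (hr : 0 < r) (hr' : r ^ 2 + r ≤ 1) :
    ∃ U ⊆ EquilateralTriangle, IsOpen U ∧ Disjoint U (triMapOne r '' U) ∧
      Disjoint U (triMapTwo r '' U) ∧ Disjoint (triMapOne r '' U) (triMapTwo r '' U) ∧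
      volume (EquilateralTriangle \ (U ∪ triMapOne r '' U ∪ triMapTwo r '' U)) = 0 := by
  obtain ⟨c, hcdef⟩ : ∃ c, c = r / (1 + r) := ⟨_, rfl⟩
  have hr1 : r < 1 := by nlinarith
  have hc : r * (1 - c) = c := by rw [hcdef]; field_simp; ring
  have hc0 : 0 < c := by rw [hcdef]; positivity
  have hc2 : c < 1 / 2 := by nlinarith
  have hrc : c ≤ 1 - r := by
    rw [hcdef, div_le_iff₀ (by linarith)]
    nlinarith
  have hκ : ENNReal.ofReal (r ^ 2) + ENNReal.ofReal (r ^ 2) < 1 := by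
    rw [← ENNReal.ofReal_add (sq_nonneg r) (sq_nonneg r), ENNReal.ofReal_lt_one]
    nlinarith [sq_nonneg (r - 1 / 2)]
  have hfin : volume (midTrapezoid c) ≠ ⊤ :=
    measure_ne_top_of_subset (midTrapezoid_subset c) isCompact_equilateralTriangle.measure_ne_top
  obtain ⟨E, hEZ, hEo, hE₁, hE₂, hEnull⟩ := exists_isOpen_disjoint_images volume
    (triHomeoOne r hr) (triHomeoTwo r hr) (ENNReal.ofReal (r ^ 2)) hκ (isOpen_midTrapezoid c) hfin
    (volume_triMapOne_image r) (volume_triMapTwo_image r) (triMapOne_image_midTrapezoid hr hc hc2)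
    (triMapTwo_image_midTrapezoid hr hc hc2) (disjoint_images_midTrapezoid hr hc hrc)
    (volume_frontier_midTrapezoid c)
  change Disjoint E (triMapOne r '' E) at hE₁
  change Disjoint E (triMapTwo r '' E) at hE₂
  change volume (midTrapezoid c \ (E ∪ triMapOne r '' E ∪ triMapTwo r '' E)) = 0 at hEnull
  have hE₁Z := (Set.image_mono hEZ).trans (triMapOne_image_midTrapezoid hr hc hc2)
  have hE₂Z := (Set.image_mono hEZ).trans (triMapTwo_image_midTrapezoid hr hc hc2)
  have hT₁ := triMapOne_image_topCorner hr hc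
  have hT₂ := triMapTwo_image_topCorner hr hc
  have dTZ : Disjoint (topCorner c) (midTrapezoid c) :=
    Set.disjoint_left.2 fun p hp hq => lt_asymm hp.1 hq.1.2
  have dKZ : Disjoint (triMapOne r '' topCorner c) (midTrapezoid c) := by
    rw [hT₁]
    exact Set.disjoint_left.2 fun p hp hq => lt_asymm hp.1 hq.2.1
  have dLZ : Disjoint (triMapTwo r '' topCorner c) (midTrapezoid c) := by
    rw [hT₂]
    exact Set.disjoint_left.2 fun p hp hq => lt_asymm hp.1 hq.2.2
  have dTK : Disjoint (topCorner c) (triMapOne r '' topCorner c) := by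
    rw [hT₁]
    exact Set.disjoint_left.2 fun p hp hq => by linarith [baryLeft_eq p, hp.1, hq.1, hq.2.1]
  have dTL : Disjoint (topCorner c) (triMapTwo r '' topCorner c) := by
    rw [hT₂]
    exact Set.disjoint_left.2 fun p hp hq => by linarith [baryLeft_eq p, hp.1, hq.1, hq.2.2]
  have dKL : Disjoint (triMapOne r '' topCorner c) (triMapTwo r '' topCorner c) := by
    rw [hT₁, hT₂]
    exact Set.disjoint_left.2 fun p hp hq => by linarith [baryLeft_eq p, hp.1, hq.1, hq.2.1]
  have key : ∀ {A B C D : Set (ℝ × ℝ)}, Disjoint A C → Disjoint A (midTrapezoid c) →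
      Disjoint C (midTrapezoid c) → B ⊆ midTrapezoid c → D ⊆ midTrapezoid c → Disjoint B D →
      Disjoint (A ∪ B) (C ∪ D) := by
    intro A B C D hAC hA hC hB hD hBD
    exact (hAC.union_right (hA.mono_right hD)).union_left
      ((hC.symm.mono_left hB).union_right hBD)
  refine ⟨topCorner c ∪ E, Set.union_subset (topCorner_subset hc0.le)
    (hEZ.trans (midTrapezoid_subset c)), (isOpen_topCorner c).union hEo, ?_, ?_, ?_, ?_⟩
  · rw [Set.image_union]
    exact key dTK dTZ dKZ hEZ hE₁Z hE₁
  · rw [Set.image_union]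
    exact key dTL dTZ dLZ hEZ hE₂Z hE₂
  · rw [Set.image_union, Set.image_union]
    exact key dKL dKZ dLZ hE₁Z hE₂Z ((disjoint_images_midTrapezoid hr hc hrc).mono
      (Set.image_mono hEZ) (Set.image_mono hEZ))
  · refine measure_mono_null (fun p hp => ?_)
      (measure_union_null (volume_triangle_diff_corners hr hc) hEnull)
    rw [Set.image_union, Set.image_union] at hp
    simp only [Set.mem_union, Set.mem_sdiff] at hp ⊢
    tauto

theorem inv_goldenConj_sq : ((3 + Real.sqrt 5) / 2) * ((Real.sqrt 5 - 1) / 2) ^ 2 = 1 := by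
  have h5 : Real.sqrt 5 * Real.sqrt 5 = 5 := Real.mul_self_sqrt (by norm_num)
  linear_combination ((Real.sqrt 5 + 1) / 8) * h5

/-- For every `a ≥ (3+√5)/2` the equilateral triangle admits a dissection into three
similar pieces with area ratio `1 : 1 : a`: explicitly, for each `r ∈ (0, (√5-1)/2]`
the maps `f₁, f₂` admit a dissection whose pieces `f₁(X), f₂(X), X` have areas in
ratio `1 : 1 : r⁻²`, and `r⁻²` covers `[(3+√5)/2, ∞)`. -/
theorem equilateral_triangle_dissection_ratio :
    (∀ a : ℝ, (3 + Real.sqrt 5) / 2 ≤ a →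
      ∃ r : ℝ, 0 < r ∧ r ≤ (Real.sqrt 5 - 1) / 2 ∧ 1 / r ^ 2 = a) ∧
    ∀ r : ℝ, 0 < r → r ≤ (Real.sqrt 5 - 1) / 2 →
      ∃ X : Set (ℝ × ℝ), IsCompact X ∧ X = closure (interior X) ∧
        EquilateralTriangle = X ∪ triMapOne r '' X ∪ triMapTwo r '' X ∧
        volume (X ∩ triMapOne r '' X) = 0 ∧
        volume (X ∩ triMapTwo r '' X) = 0 ∧
        volume (triMapOne r '' X ∩ triMapTwo r '' X) = 0 ∧
        volume (triMapTwo r '' X) = volume (triMapOne r '' X) ∧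
        volume X = ENNReal.ofReal (1 / r ^ 2) * volume (triMapOne r '' X) := by
  have h5 : Real.sqrt 5 * Real.sqrt 5 = 5 := Real.mul_self_sqrt (by norm_num)
  have h51 : 1 < Real.sqrt 5 := by
    rw [Real.lt_sqrt] <;> norm_num
  refine ⟨fun a ha => ?_, fun r hr hr' => ?_⟩
  · have ha0 : 0 < a := by linarith
    refine ⟨1 / Real.sqrt a, by positivity, ?_, ?_⟩
    · rw [div_le_iff₀ (by positivity), ← div_le_iff₀' (by linarith)]
      refine Real.le_sqrt_of_sq_le (le_trans (le_of_eq ?_) ha)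
      rw [div_pow, one_pow, div_eq_iff (by nlinarith), inv_goldenConj_sq]
    · rw [div_pow, Real.sq_sqrt ha0.le]
      simp
  · have hrr : r ^ 2 + r ≤ 1 := by nlinarith
    have hr1 : r ≤ 1 := by nlinarith
    obtain ⟨U, hUD, hU, h₁, h₂, h₁₂, hnull⟩ := exists_isOpen_tiling hr hrr
    have hD := isCompact_equilateralTriangle
    obtain ⟨hcover, n₁, n₂, n₁₂⟩ := dissection_closure volume (triHomeoOne r hr)
      (triHomeoTwo r hr) hD.isClosed subset_closure_interior_equilateralTriangle hU hUD
      (triMapOne_image_subset hr.le hr1) (triMapTwo_image_subset hr.le hr1) h₁ h₂ h₁₂ hnull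
    refine ⟨closure U, hD.of_isClosed_subset isClosed_closure (closure_minimal hUD hD.isClosed),
      by rw [← hU.interior_eq, closure_interior_idem], hcover, n₁, n₂, n₁₂, ?_, ?_⟩
    · rw [volume_triMapOne_image, volume_triMapTwo_image]
    · rw [volume_triMapOne_image, ← mul_assoc, ← ENNReal.ofReal_mul (by positivity),
        one_div_mul_cancel (by positivity), ENNReal.ofReal_one, one_mul]
end
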